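/- arXiv:1904.10385 — 3 statements merged into one kernel-verified Lean document; each statement's English description precedes it below -/
import Mathlib

section
/- For every continuous f : [0,∞) → X and all 0 ≤ s ≤ t, the following identities hold in X₀: (S ⋄ f)(t) = T₀(t−s)((S ⋄ f)(s)) + (S ⋄ f(s+·))(t−s), where f(s+·) denotes the function r ↦ f(s+r); and (S ⋄ f)(t) = lim_{h→0⁺} (1/h) ∫₀ᵗ T₀(t−r)(S(h)(f(r))) dr, the limit being taken in the norm of X₀. -/
open Set Filter MeasureTheory
open scoped Topology

noncomputable section

structure MRSetting (X : Type*) [NormedAddCommGroup X] [NormedSpace ℂ X] [CompleteSpace X]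
    (X₀ : Submodule ℂ X) where
  closed : IsClosed (X₀ : Set X)
  T : ℝ → (X₀ →L[ℂ] X₀)
  S : ℝ → (X →L[ℂ] X₀)
  T_zero : T 0 = 1
  T_add : ∀ t s : ℝ, 0 ≤ t → 0 ≤ s → T (t + s) = (T t).comp (T s)
  T_cont : ∀ x : X₀, ContinuousOn (fun t => T t x) (Ici 0)
  S_zero : S 0 = 0
  S_cont : ∀ x : X, ContinuousOn (fun t => S t x) (Ici 0)
  TS : ∀ t s : ℝ, 0 ≤ t → 0 ≤ s → ∀ x : X, T t (S s x) = S (t + s) x - S t x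
  δ : ℝ → ℝ
  δ_nonneg : ∀ t : ℝ, 0 ≤ t → 0 ≤ δ t
  δ_mono : MonotoneOn δ (Ici 0)
  δ_lim : Tendsto δ (𝓝[>] 0) (𝓝 0)
  SD : (ℝ → X) → ℝ → X₀
  SD_deriv : ∀ f : ℝ → X, ContinuousOn f (Ici 0) → ∀ t ∈ Ici (0:ℝ),
    HasDerivWithinAt (fun τ : ℝ => ∫ s in (0:ℝ)..τ, S (τ - s) (f s)) (SD f t) (Ici 0) t
  SD_cont : ∀ f : ℝ → X, ContinuousOn f (Ici 0) → ContinuousOn (SD f) (Ici 0)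
  SD_bound : ∀ f : ℝ → X, ContinuousOn f (Ici 0) → ∀ t ∈ Ici (0:ℝ),
    ‖SD f t‖ ≤ δ t * ⨆ s : Icc (0:ℝ) t, ‖f (s : ℝ)‖
  SDop : (ℝ → (X₀ →L[ℂ] X)) → ℝ → (X₀ →L[ℂ] X₀)
  SDop_apply : ∀ V : ℝ → (X₀ →L[ℂ] X), (∀ x : X₀, ContinuousOn (fun s => V s x) (Ici 0)) →
    ∀ t : ℝ, ∀ x : X₀, SDop V t x = SD (fun s => V s x) t

variable {X : Type*} [NormedAddCommGroup X] [NormedSpace ℂ X] [CompleteSpace X]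
  {X₀ : Submodule ℂ X}

/-- The perturbation operator `B(U) = S ⋄ (L ∘ U)`. -/
def MRSetting.Bop (M : MRSetting X X₀) (L : X₀ →L[ℂ] X) (U : ℝ → (X₀ →L[ℂ] X₀)) :
    ℝ → (X₀ →L[ℂ] X₀) :=
  M.SDop (fun s => L.comp (U s))


lemma MRSetting.aux_cont (M : MRSetting X X₀) (f : ℝ → X) (hf : ContinuousOn f (Ici 0)) (c : ℝ) :
    ContinuousOn (fun r => M.S (c - r) (f r)) (Icc 0 c) := by
  obtain ⟨C, hC⟩ : ∃ C, ∀ i : Icc (0:ℝ) c, ‖M.S (i : ℝ)‖ ≤ C := by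
    apply banach_steinhaus
    intro x
    obtain ⟨C, hC⟩ := (isCompact_Icc (a := (0:ℝ)) (b := c)).exists_bound_of_continuousOn
      ((M.S_cont x).mono (fun y hy => hy.1))
    exact ⟨C, fun i => hC i i.2⟩
  intro r₀ hr₀
  have hsub : MapsTo (fun r : ℝ => c - r) (Icc 0 c) (Ici 0) := fun r hr => by
    simp only [mem_Ici]; linarith [hr.2]
  have h1 : Tendsto (fun r => M.S (c - r) (f r₀)) (𝓝[Icc 0 c] r₀) (𝓝 (M.S (c - r₀) (f r₀))) :=
    (ContinuousOn.comp (M.S_cont (f r₀)) (by fun_prop : ContinuousOn (fun r : ℝ => c - r) (Icc 0 c))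
      hsub) r₀ hr₀
  have h2 : Tendsto (fun r => M.S (c - r) (f r - f r₀)) (𝓝[Icc 0 c] r₀) (𝓝 0) := by
    have hfr : Tendsto (fun r => C * ‖f r - f r₀‖) (𝓝[Icc 0 c] r₀) (𝓝 0) := by
      have := (hf.mono (fun y (hy : y ∈ Icc 0 c) => hy.1)) r₀ hr₀
      have h3 := (tendsto_iff_norm_sub_tendsto_zero.1 this).const_mul C
      simpa using h3
    refine squeeze_zero_norm' ?_ hfr
    filter_upwards [self_mem_nhdsWithin] with r hr
    refine (M.S (c - r)).le_of_opNorm_le (hC ⟨c - r, ?_, ?_⟩) _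
    · linarith [hr.2]
    · linarith [hr.1]
  have h3 := h1.add h2
  simp only [map_sub, add_sub_cancel, add_zero] at h3
  exact h3

lemma MRSetting.aux_int (M : MRSetting X X₀) (f : ℝ → X) (hf : ContinuousOn f (Ici 0))
    (a b c : ℝ) (ha : 0 ≤ a) (hab : a ≤ b) (hbc : b ≤ c) :
    IntervalIntegrable (fun r => M.S (c - r) (f r)) volume a b := by
  apply ContinuousOn.intervalIntegrable
  rw [uIcc_of_le hab]
  exact (M.aux_cont f hf c).mono (Icc_subset_Icc ha hbc)

lemma MRSetting.aux_TS (M : MRSetting X X₀) (f : ℝ → X) (t h : ℝ) (hh : 0 ≤ h)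
    (r : ℝ) (hr : r ≤ t) :
    M.T (t - r) (M.S h (f r)) = M.S (t + h - r) (f r) - M.S (t - r) (f r) := by
  rw [M.TS _ _ (by linarith) hh]
  congr 3
  ring_nf

lemma MRSetting.aux_intT (M : MRSetting X X₀) (f : ℝ → X) (hf : ContinuousOn f (Ici 0))
    (a b t h : ℝ) (ha : 0 ≤ a) (hab : a ≤ b) (hbt : b ≤ t) (hh : 0 ≤ h) :
    IntervalIntegrable (fun r => M.T (t - r) (M.S h (f r))) volume a b := by
  refine ((M.aux_int f hf a b (t + h) ha hab (by linarith)).sub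
    (M.aux_int f hf a b t ha hab hbt)).congr ?_
  intro r hr
  rw [uIoc_of_le hab] at hr
  exact (M.aux_TS f t h hh r (hr.2.trans hbt)).symm

lemma MRSetting.shift_cont (f : ℝ → X) (hf : ContinuousOn f (Ici 0)) (s : ℝ) (hs : 0 ≤ s) :
    ContinuousOn (fun r => f (s + r)) (Ici 0) :=
  hf.comp (by fun_prop) (fun r hr => by
    simp only [mem_Ici] at hr ⊢; linarith)

lemma MRSetting.SD_at_zero (M : MRSetting X X₀) (f : ℝ → X) (hf : ContinuousOn f (Ici 0)) :
    M.SD f 0 = 0 := by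
  have h0 : M.δ 0 = 0 := by
    refine le_antisymm ?_ (M.δ_nonneg 0 le_rfl)
    refine ge_of_tendsto M.δ_lim ?_
    filter_upwards [self_mem_nhdsWithin] with h hh
    exact M.δ_mono (by simp) (le_of_lt hh : (0:ℝ) ≤ h) (le_of_lt hh)
  have := M.SD_bound f hf 0 (by simp)
  rw [h0, zero_mul] at this
  exact norm_le_zero_iff.1 this

lemma MRSetting.lim_formula (M : MRSetting X X₀)
    (f : ℝ → X) (hf : ContinuousOn f (Ici 0)) (t : ℝ) (ht : 0 ≤ t) :
    Tendsto (fun h : ℝ => (1 / h) • ∫ r in (0:ℝ)..t, M.T (t - r) (M.S h (f r)))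
      (𝓝[>] 0) (𝓝 (M.SD f t)) := by
  have key : ∀ g : ℝ → X, ContinuousOn g (Ici 0) → ∀ u : ℝ, 0 ≤ u →
      Tendsto (fun h : ℝ => h⁻¹ • ((∫ r in (0:ℝ)..(u + h), M.S (u + h - r) (g r)) -
        ∫ r in (0:ℝ)..u, M.S (u - r) (g r))) (𝓝[>] 0) (𝓝 (M.SD g u)) := by
    intro g hg u hu
    have h1 : HasDerivWithinAt (fun τ : ℝ => ∫ s in (0:ℝ)..τ, M.S (τ - s) (g s)) (M.SD g u)
        (Ici u) u := (M.SD_deriv g hg u hu).mono (Ici_subset_Ici.2 hu)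
    have h2 := (hasDerivWithinAt_iff_tendsto_slope' self_notMem_Ioi).1 h1.Ioi_of_Ici
    have h3 : Tendsto (fun h : ℝ => u + h) (𝓝[>] 0) (𝓝[>] u) := by
      refine tendsto_nhdsWithin_iff.2 ⟨?_, ?_⟩
      · have : Tendsto (fun h : ℝ => u + h) (𝓝 0) (𝓝 (u + 0)) :=
          (continuous_const.add continuous_id).tendsto 0
        rw [add_zero] at this
        exact this.mono_left nhdsWithin_le_nhds
      · filter_upwards [self_mem_nhdsWithin] with h hh
        have hh : 0 < h := hh
        simp only [mem_Ioi]; linarith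
    refine (h2.comp h3).congr ?_
    intro h
    simp [slope]
  have hg := MRSetting.shift_cont f hf t ht
  have A := key f hf t ht
  have B := key _ hg 0 le_rfl
  rw [M.SD_at_zero _ hg] at B
  have C := A.sub B
  rw [sub_zero] at C
  refine C.congr' ?_
  filter_upwards [self_mem_nhdsWithin] with h hh
  have hh : 0 < h := hh
  rw [← smul_sub, one_div]
  congr 1
  have e1 : ∫ r in (0:ℝ)..t, M.T (t - r) (M.S h (f r)) =
      (∫ r in (0:ℝ)..t, M.S (t + h - r) (f r)) - ∫ r in (0:ℝ)..t, M.S (t - r) (f r) := by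
    rw [← intervalIntegral.integral_sub (M.aux_int f hf 0 t (t + h) le_rfl ht (by linarith))
      (M.aux_int f hf 0 t t le_rfl ht le_rfl)]
    apply intervalIntegral.integral_congr
    intro r hr
    rw [uIcc_of_le ht] at hr
    exact M.aux_TS f t h hh.le r hr.2
  have e2 := intervalIntegral.integral_add_adjacent_intervals
    (M.aux_int f hf 0 t (t + h) le_rfl ht (by linarith))
    (M.aux_int f hf t (t + h) (t + h) ht (by linarith) le_rfl)
  have e3 : ∫ r in (0:ℝ)..(0 + h), M.S (0 + h - r) (f (t + r)) =
      ∫ r in t..(t + h), M.S (t + h - r) (f r) := by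
    have := intervalIntegral.integral_comp_add_left (a := 0) (b := h)
      (fun r => M.S (t + h - r) (f r)) t
    rw [add_zero] at this
    rw [← this, zero_add]
    congr 1
    ext r
    congr 3
    ring_nf
  rw [e1, e3, ← e2, intervalIntegral.integral_same]
  abel

/-- the two identities for `S ⋄ f`. -/
theorem diamond_identities (M : MRSetting X X₀)
    (f : ℝ → X) (hf : ContinuousOn f (Ici 0))
    (s t : ℝ) (hs : 0 ≤ s) (hst : s ≤ t) :
    M.SD f t = M.T (t - s) (M.SD f s) + M.SD (fun r => f (s + r)) (t - s) ∧
    Tendsto (fun h : ℝ => (1 / h) • ∫ r in (0:ℝ)..t, M.T (t - r) (M.S h (f r)))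
      (𝓝[>] 0) (𝓝 (M.SD f t)) := by
  have ht : 0 ≤ t := hs.trans hst
  have L := M.lim_formula f hf t ht
  refine ⟨?_, L⟩
  have : CompleteSpace X₀ := M.closed.completeSpace_coe
  have hg := MRSetting.shift_cont f hf s hs
  have A := ((M.T (t - s)).continuous.tendsto _).comp (M.lim_formula f hf s hs)
  have B := M.lim_formula _ hg (t - s) (by linarith)
  refine tendsto_nhds_unique L ((A.add B).congr' ?_)
  filter_upwards [self_mem_nhdsWithin] with h hh
  have hh : 0 < h := hh
  have e1 := intervalIntegral.integral_add_adjacent_intervals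
    (M.aux_intT f hf 0 s t h le_rfl hs hst hh.le) (M.aux_intT f hf s t t h hs hst le_rfl hh.le)
  have e2 : ∫ r in (0:ℝ)..(t - s), M.T (t - s - r) (M.S h (f (s + r))) =
      ∫ r in s..t, M.T (t - r) (M.S h (f r)) := by
    have := intervalIntegral.integral_comp_add_left (a := 0) (b := t - s)
      (fun r => M.T (t - r) (M.S h (f r))) s
    rw [add_zero, add_sub_cancel] at this
    rw [← this]
    congr 1
    ext r
    congr 3
    ring_nf
  have e3 : M.T (t - s) (∫ r in (0:ℝ)..s, M.T (s - r) (M.S h (f r))) =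
      ∫ r in (0:ℝ)..s, M.T (t - r) (M.S h (f r)) := by
    rw [← ContinuousLinearMap.intervalIntegral_comp_comm _
      (M.aux_intT f hf 0 s s h le_rfl hs le_rfl hh.le)]
    apply intervalIntegral.integral_congr
    intro r hr
    rw [uIcc_of_le hs] at hr
    have := M.T_add (t - s) (s - r) (by linarith) (by linarith [hr.2])
    rw [show t - s + (s - r) = t - r by ring] at this
    simp only [this]
    rfl
  simp only [Function.comp]
  rw [← e1, e2, smul_add, ← e3]
  congr 1
  exact ((M.T (t - s)).restrictScalars ℝ).map_smul _ _

end
end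

section
/- Let t₁ ≥ 0 and n ≥ 0. (c) If Sₙ(t) is a compact operator for every t > t₁, then Sₙ is norm continuous on (t₁, ∞). (d) If Rₙ(t) is a compact operator for every t > t₁, then Rₙ is norm continuous on (t₁, ∞). -/
open Set Filter MeasureTheory
open scoped Topology

noncomputable section

variable {X : Type*} [NormedAddCommGroup X] [NormedSpace ℂ X] [CompleteSpace X]
  {X₀ : Submodule ℂ X}

section Helpers

variable {E F : Type*} [NormedAddCommGroup E] [NormedSpace ℂ E] [CompleteSpace E]
  [NormedAddCommGroup F] [NormedSpace ℂ F]

/-- Strongly continuous families are locally bounded. -/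
lemma sc_bdd (V : ℝ → (E →L[ℂ] F)) (hV : ∀ x, ContinuousOn (fun t => V t x) (Ici 0)) (b : ℝ) :
    ∃ C, 0 ≤ C ∧ ∀ t, 0 ≤ t → t ≤ b → ‖V t‖ ≤ C := by
  obtain ⟨C, hC⟩ := banach_steinhaus (g := fun t : Icc (0:ℝ) b => V t) (by
    intro x
    obtain ⟨C, hC⟩ := isCompact_Icc.exists_bound_of_continuousOn
      ((hV x).mono (Icc_subset_Ici_self : Icc (0:ℝ) b ⊆ Ici 0))
    exact ⟨C, fun i => hC i i.2⟩)
  exact ⟨max C 0, le_max_right _ _, fun t h0 hb => (hC ⟨t, h0, hb⟩).trans (le_max_left _ _)⟩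

lemma sc_joint (V : ℝ → (E →L[ℂ] F)) (hV : ∀ x, ContinuousOn (fun t => V t x) (Ici 0)) :
    ContinuousOn (fun p : ℝ × E => V p.1 p.2) (Ici 0 ×ˢ univ) := by
  rintro ⟨t, x⟩ ⟨ht, -⟩
  obtain ⟨C, hC0, hC⟩ := sc_bdd V hV (t + 1)
  rw [ContinuousWithinAt, tendsto_iff_norm_sub_tendsto_zero]
  have h1 : Tendsto (fun p : ℝ × E => ‖V p.1 x - V t x‖) (𝓝[Ici 0 ×ˢ univ] (t, x)) (𝓝 0) := by
    rw [← tendsto_iff_norm_sub_tendsto_zero]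
    have : ContinuousWithinAt (fun p : ℝ × E => V p.1 x) (Ici 0 ×ˢ univ) (t, x) :=
      ContinuousWithinAt.comp (t := Ici 0) (g := fun t => V t x) (f := Prod.fst)
        (hV x t ht) continuous_fst.continuousWithinAt (fun p hp => hp.1)
    exact this
  have h2 : Tendsto (fun p : ℝ × E => C * ‖p.2 - x‖) (𝓝[Ici 0 ×ˢ univ] (t, x)) (𝓝 0) := by
    have : Continuous (fun p : ℝ × E => C * ‖p.2 - x‖) := by fun_prop
    have := this.tendsto (t, x)
    simp only [sub_self, norm_zero, mul_zero] at this
    exact this.mono_left nhdsWithin_le_nhds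
  have h3 := h2.add h1
  rw [add_zero] at h3
  refine squeeze_zero' (Eventually.of_forall fun _ => norm_nonneg _) ?_ h3
  have hev : ∀ᶠ p : ℝ × E in 𝓝[Ici 0 ×ˢ univ] (t, x), p.1 < t + 1 :=
    nhdsWithin_le_nhds (continuous_fst.continuousAt.eventually_lt continuousAt_const (by simp))
  filter_upwards [hev, self_mem_nhdsWithin] with p hp hp'
  have : V p.1 p.2 - V t x = V p.1 (p.2 - x) + (V p.1 x - V t x) := by rw [map_sub]; abel
  rw [this]
  refine (norm_add_le _ _).trans ?_
  gcongr
  exact ContinuousLinearMap.le_of_opNorm_le _ (hC p.1 hp'.1 hp.le) _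

lemma sc_comp (V : ℝ → (E →L[ℂ] F)) (hV : ∀ x, ContinuousOn (fun t => V t x) (Ici 0))
    {f : ℝ → E} {g : ℝ → ℝ} {s : Set ℝ} (hf : ContinuousOn f s) (hg : ContinuousOn g s)
    (hgs : ∀ r ∈ s, 0 ≤ g r) : ContinuousOn (fun r => V (g r) (f r)) s :=
  ContinuousOn.comp (g := fun p : ℝ × E => V p.1 p.2) (f := fun r => (g r, f r))
    (sc_joint V hV) (hg.prodMk hf) (fun r hr => ⟨hgs r hr, mem_univ _⟩)

/-- A strongly continuous family composed with a compact operator is norm continuous. -/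
lemma sc_compact (V : ℝ → (E →L[ℂ] F)) (hV : ∀ x, ContinuousOn (fun t => V t x) (Ici 0))
    (K : E →L[ℂ] E) (hK : IsCompactOperator K) (t : ℝ) (ht : 0 < t) (ε : ℝ) (hε : 0 < ε) :
    ∀ᶠ r in 𝓝 t, ‖(V r).comp K - (V t).comp K‖ ≤ ε := by
  obtain ⟨Q, hQ, hQK⟩ := IsCompactOperator.image_closedBall_subset_compact (f := K.toLinearMap) hK 1
  obtain ⟨v, hv, hvp⟩ := hQ.mem_uniformity_of_prod (f := fun r y => V r y) (s := Ici 0) (q := t)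
    ((sc_joint V hV).mono (prod_mono_right (subset_univ _))) ht.le (Metric.dist_mem_uniformity hε)
  rw [mem_nhdsWithin_iff_eventually] at hv
  filter_upwards [hv, Ioi_mem_nhds ht] with r hr hr0
  refine ContinuousLinearMap.opNorm_le_of_unit_norm hε.le fun x hx => ?_
  have := hvp r (hr (mem_Ici.2 (le_of_lt hr0))) (K x) (hQK ⟨x, by simp [hx], rfl⟩)
  have h2 : dist (V r (K x)) (V t (K x)) < ε := this
  rw [dist_eq_norm] at h2
  exact h2.le

lemma abstract_main (T : ℝ → (E →L[ℂ] E)) (hT : ∀ x, ContinuousOn (fun t => T t x) (Ici 0))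
    (δ : ℝ → ℝ) (hδ : Tendsto δ (𝓝[>] 0) (𝓝 0)) (W : ℝ → (E →L[ℂ] E))
    (hW : ∀ b : ℝ, ∃ C, 0 ≤ C ∧ ∀ s h, 0 ≤ s → 0 ≤ h → s + h ≤ b →
      ‖W (s + h) - (T h).comp (W s)‖ ≤ C * δ h) (t₁ : ℝ) (ht₁ : 0 ≤ t₁)
    (hc : ∀ t : ℝ, t₁ < t → IsCompactOperator ⇑(W t)) : ContinuousOn W (Ioi t₁) := by
  intro t ht
  rw [mem_Ioi] at ht
  apply ContinuousAt.continuousWithinAt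
  refine (Metric.continuousAt_iff' (f := W) (b := t)).2 ?_
  intro ε hε
  obtain ⟨C, hC0, hC⟩ := hW (t + 1)
  have hlim : Tendsto (fun h => C * δ h) (𝓝[>] 0) (𝓝 0) := by
    simpa using hδ.const_mul C
  have hev := hlim.eventually (gt_mem_nhds (show (0:ℝ) < ε / 4 by positivity))
  obtain ⟨η, hη, hη'⟩ := mem_nhdsGT_iff_exists_Ioo_subset.1 hev
  rw [mem_Ioi] at hη
  set m := min η (t - t₁) with hm
  have hm0 : 0 < m := lt_min hη (by linarith)
  have hm1 : m ≤ η := min_le_left _ _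
  have hm2 : m ≤ t - t₁ := min_le_right _ _
  have hs1 : t₁ < t - m / 2 := by linarith
  set s := t - m / 2 with hs
  have hts : 0 < t - s := by rw [hs]; linarith
  have h1 := sc_compact T hT (W s) (hc s hs1) (t - s) hts (ε / 4) (by positivity)
  have hcont : Tendsto (fun r => r - s) (𝓝 t) (𝓝 (t - s)) :=
    (continuous_id.sub continuous_const).tendsto t
  have happ : ∀ r, s < r → r < s + η → r ≤ t + 1 →
      ‖W r - (T (r - s)).comp (W s)‖ ≤ ε / 4 := by
    intro r hr1 hr2 hr3
    have a := hC s (r - s) (by linarith) (by linarith) (by linarith)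
    rw [add_sub_cancel] at a
    have b : C * δ (r - s) < ε / 4 := hη' ⟨by linarith, by linarith⟩
    linarith
  have ht' := happ t (by linarith) (by rw [hs]; linarith) (by linarith)
  filter_upwards [hcont.eventually h1, Ioi_mem_nhds (show s < t by linarith),
    Iio_mem_nhds (show t < s + η by rw [hs]; linarith),
    Iio_mem_nhds (show t < t + 1 by linarith)] with r hr1 hr2 hr3 hr4
  have hr' := happ r hr2 hr3 (le_of_lt hr4)
  rw [dist_eq_norm]
  have e : W r - W t = (W r - (T (r - s)).comp (W s))
      + ((T (r - s)).comp (W s) - (T (t - s)).comp (W s))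
      - (W t - (T (t - s)).comp (W s)) := by abel
  rw [e]
  have := norm_sub_le ((W r - (T (r - s)).comp (W s))
      + ((T (r - s)).comp (W s) - (T (t - s)).comp (W s))) (W t - (T (t - s)).comp (W s))
  have := norm_add_le (W r - (T (r - s)).comp (W s))
      ((T (r - s)).comp (W s) - (T (t - s)).comp (W s))
  linarith

end Helpers

namespace MRSetting

lemma complete (M : MRSetting X X₀) : CompleteSpace X₀ := M.closed.completeSpace_coe

lemma δ_zero (M : MRSetting X X₀) : M.δ 0 = 0 := by
  refine le_antisymm (ge_of_tendsto M.δ_lim ?_) (M.δ_nonneg 0 le_rfl)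
  filter_upwards [self_mem_nhdsWithin] with t ht
  exact M.δ_mono (mem_Ici.2 le_rfl) (mem_Ici.2 (le_of_lt ht)) (le_of_lt ht)

lemma int_add (M : MRSetting X X₀) (f : ℝ → X) (hf : ContinuousOn f (Ici 0)) (t h : ℝ)
    (ht : 0 ≤ t) (hh : 0 ≤ h) :
    (∫ s in (0:ℝ)..(t + h), M.S (t + h - s) (f s)) - (∫ s in (0:ℝ)..h, M.S (h - s) (f (t + s)))
      = M.T h (∫ s in (0:ℝ)..t, M.S (t - s) (f s)) + M.S h (∫ s in (0:ℝ)..t, f s) := by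
  have := M.complete
  have key : ∀ b c : ℝ, 0 ≤ b → ∀ a, 0 ≤ a → a ≤ b → b ≤ c →
      IntervalIntegrable (fun s => M.S (c - s) (f s)) volume a b := by
    intro b c hb a ha hab hbc
    apply ContinuousOn.intervalIntegrable
    rw [uIcc_of_le hab]
    exact sc_comp M.S M.S_cont (hf.mono fun s hs => ha.trans hs.1) (by fun_prop)
      (fun r hr => by linarith [hr.2])
  have e1 : (∫ s in (0:ℝ)..h, M.S (h - s) (f (t + s)))
      = ∫ s in t..(t + h), M.S (t + h - s) (f s) := by
    have := intervalIntegral.integral_comp_add_left (a := 0) (b := h)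
      (fun s => M.S (t + h - s) (f s)) t
    rw [add_zero] at this
    rw [← this]
    simp only [add_sub_add_left_eq_sub]
  rw [e1, ← intervalIntegral.integral_add_adjacent_intervals
    (key t (t + h) ht 0 le_rfl ht (by linarith))
    (key (t + h) (t + h) (by linarith) t ht (by linarith) le_rfl), add_sub_cancel_right]
  have hfi : IntervalIntegrable f volume 0 t := by
    apply ContinuousOn.intervalIntegrable
    rw [uIcc_of_le ht]
    exact hf.mono Icc_subset_Ici_self
  have hSi := key t t ht 0 le_rfl ht le_rfl
  rw [← ContinuousLinearMap.intervalIntegral_comp_comm _ hSi,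
    ← ContinuousLinearMap.intervalIntegral_comp_comm _ hfi,
    ← intervalIntegral.integral_add]
  · apply intervalIntegral.integral_congr
    intro s hs
    rw [uIcc_of_le ht] at hs
    simp only
    rw [M.TS h (t - s) hh (by linarith [hs.2])]
    rw [sub_add_cancel]
    congr 2
    ring
  · exact ⟨(M.T h).integrable_comp hSi.1, (M.T h).integrable_comp hSi.2⟩
  · exact ⟨(M.S h).integrable_comp hfi.1, (M.S h).integrable_comp hfi.2⟩

/-- The shift identity for `S ⋄ f`. -/
lemma SD_add (M : MRSetting X X₀) (f : ℝ → X) (hf : ContinuousOn f (Ici 0)) (t h : ℝ)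
    (ht : 0 ≤ t) (hh : 0 ≤ h) :
    M.SD f (t + h) = M.T h (M.SD f t) + M.SD (fun s => f (t + s)) h := by
  have hg : ContinuousOn (fun s => f (t + s)) (Ici 0) :=
    hf.comp (by fun_prop) (fun s hs => add_nonneg ht hs)
  have hg0 : M.SD (fun s => f (t + s)) 0 = 0 := by
    have := M.SD_bound _ hg 0 (mem_Ici.2 le_rfl)
    rw [M.δ_zero, zero_mul] at this
    exact norm_le_zero_iff.1 this
  set P : ℝ → X₀ := fun h => (∫ s in (0:ℝ)..(t + h), M.S (t + h - s) (f s))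
    - (∫ s in (0:ℝ)..h, M.S (h - s) (f (t + s))) with hP
  have hPd : ∀ h, 0 ≤ h → HasDerivWithinAt P (M.SD f (t + h) - M.SD (fun s => f (t + s)) h)
      (Ici 0) h := by
    intro h hh
    refine HasDerivWithinAt.sub ?_ (M.SD_deriv _ hg h hh)
    have h1 := M.SD_deriv f hf (t + h) (add_nonneg ht hh)
    have h2 : HasDerivWithinAt (fun h : ℝ => t + h) 1 (Ici 0) h :=
      (hasDerivWithinAt_id h _).const_add t
    have := HasDerivWithinAt.scomp (h := fun h : ℝ => t + h) h h1 h2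
      (fun s hs => add_nonneg ht hs)
    rw [one_smul] at this
    exact this
  set J := ∫ s in (0:ℝ)..t, f s
  have hPadd : ∀ k, 0 ≤ k → P (h + k) = M.T h (P k) + M.S h J := by
    intro k hk
    simp only [hP]
    rw [M.int_add f hf t (h + k) ht (add_nonneg hh hk), M.int_add f hf t k ht hk,
      M.T_add h k hh hk, map_add, M.TS h k hh hk]
    simp only [ContinuousLinearMap.comp_apply]
    abel
  have d1 : HasDerivWithinAt (fun k => P (h + k))
      (M.SD f (t + h) - M.SD (fun s => f (t + s)) h) (Ici 0) 0 := by
    have h1 := hPd h hh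
    have h2 : HasDerivWithinAt (fun k : ℝ => h + k) 1 (Ici 0) 0 :=
      (hasDerivWithinAt_id 0 _).const_add h
    have := HasDerivWithinAt.scomp (g₁ := P) (h := fun k : ℝ => h + k) (t' := Ici 0) 0
      (by rw [add_zero]; exact h1) h2 (fun s hs => add_nonneg hh hs)
    rw [one_smul] at this
    exact this
  have d2 : HasDerivWithinAt (fun k => P (h + k)) (M.T h (M.SD f t)) (Ici 0) 0 := by
    have h0 := hPd 0 le_rfl
    rw [hg0, add_zero, sub_zero] at h0
    have h1 : HasDerivWithinAt (fun k => M.T h (P k) + M.S h J) (M.T h (M.SD f t)) (Ici 0) 0 :=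
      ((((M.T h).restrictScalars ℝ).hasFDerivAt.comp_hasDerivWithinAt 0 h0)).add_const _
    exact h1.congr (fun k hk => hPadd k hk) (hPadd 0 le_rfl)
  have := (uniqueDiffWithinAt_Ici (0:ℝ)).eq_deriv _ d1 d2
  rw [← this]; abel

lemma Bop_sc (M : MRSetting X X₀) (L : X₀ →L[ℂ] X) (U : ℝ → (X₀ →L[ℂ] X₀))
    (hU : ∀ x, ContinuousOn (fun t => U t x) (Ici 0)) (x : X₀) :
    ContinuousOn (fun t => M.Bop L U t x) (Ici 0) := by
  have hV : ∀ x, ContinuousOn (fun t => L.comp (U t) x) (Ici 0) := fun x =>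
    L.continuous.comp_continuousOn (hU x)
  have : (fun t => M.Bop L U t x) = M.SD (fun s => L.comp (U s) x) := by
    funext t
    exact M.SDop_apply _ hV t x
  rw [this]
  exact M.SD_cont _ (hV x)

lemma iter_sc (M : MRSetting X X₀) (L : X₀ →L[ℂ] X) (U : ℝ → (X₀ →L[ℂ] X₀))
    (hU : ∀ x, ContinuousOn (fun t => U t x) (Ici 0)) (n : ℕ) :
    ∀ x, ContinuousOn (fun t => (M.Bop L)^[n] U t x) (Ici 0) := by
  induction n with
  | zero => simpa using hU
  | succ n ih =>
    rw [Function.iterate_succ_apply']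
    exact M.Bop_sc L _ ih

/-- Approximate semigroup property. -/
def Approx (M : MRSetting X X₀) (W : ℝ → (X₀ →L[ℂ] X₀)) : Prop :=
  ∀ b : ℝ, ∃ C, 0 ≤ C ∧ ∀ s h, 0 ≤ s → 0 ≤ h → s + h ≤ b →
    ‖W (s + h) - (M.T h).comp (W s)‖ ≤ C * M.δ h

lemma Bop_approx (M : MRSetting X X₀) (L : X₀ →L[ℂ] X) (U : ℝ → (X₀ →L[ℂ] X₀))
    (hU : ∀ x, ContinuousOn (fun t => U t x) (Ici 0)) : M.Approx (M.Bop L U) := by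
  have := M.complete
  have hV : ∀ x, ContinuousOn (fun t => L.comp (U t) x) (Ici 0) := fun x =>
    L.continuous.comp_continuousOn (hU x)
  intro b
  obtain ⟨C, hC0, hC⟩ := sc_bdd (fun t => L.comp (U t)) hV b
  refine ⟨C, hC0, fun s h hs hh hb => ?_⟩
  have hδ := M.δ_nonneg h hh
  refine ContinuousLinearMap.opNorm_le_bound _ (by positivity) fun x => ?_
  have e : (M.Bop L U (s + h) - (M.T h).comp (M.Bop L U s)) x
      = M.SD (fun r => L.comp (U (s + r)) x) h := by
    simp only [sub_apply, ContinuousLinearMap.comp_apply, Bop]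
    rw [M.SDop_apply _ hV, M.SDop_apply _ hV, M.SD_add _ (hV x) s h hs hh]
    simp only [add_sub_cancel_left, ContinuousLinearMap.comp_apply]
  rw [e]
  have hg : ContinuousOn (fun r => L.comp (U (s + r)) x) (Ici 0) :=
    (hV x).comp (f := fun r => s + r) (by fun_prop) (fun r hr => add_nonneg hs hr)
  refine (M.SD_bound _ hg h hh).trans ?_
  have : (⨆ r : Icc (0:ℝ) h, ‖L.comp (U (s + (r:ℝ))) x‖) ≤ C * ‖x‖ := by
    refine Real.iSup_le (fun r => ?_) (by positivity)
    exact ContinuousLinearMap.le_of_opNorm_le _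
      (hC (s + r) (add_nonneg hs r.2.1) (by linarith [r.2.2])) x
  calc _ ≤ M.δ h * (C * ‖x‖) := by gcongr
    _ = _ := by ring

lemma T_approx (M : MRSetting X X₀) : M.Approx M.T := by
  intro b
  refine ⟨0, le_rfl, fun s h hs hh _ => ?_⟩
  rw [add_comm, M.T_add h s hh hs, sub_self, zero_mul]
  exact le_of_eq ContinuousLinearMap.opNorm_zero

lemma main (M : MRSetting X X₀) (W : ℝ → (X₀ →L[ℂ] X₀)) (hW : M.Approx W) (t₁ : ℝ) (ht₁ : 0 ≤ t₁)
    (hc : ∀ t : ℝ, t₁ < t → IsCompactOperator ⇑(W t)) : ContinuousOn W (Ioi t₁) := by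
  have := M.complete
  exact abstract_main M.T M.T_cont M.δ M.δ_lim W hW t₁ ht₁ hc

lemma iter_approx (M : MRSetting X X₀) (L : X₀ →L[ℂ] X) (U : ℝ → (X₀ →L[ℂ] X₀))
    (hU : ∀ x, ContinuousOn (fun t => U t x) (Ici 0)) (h0 : M.Approx U) (n : ℕ) :
    M.Approx ((M.Bop L)^[n] U) := by
  cases n with
  | zero => exact h0
  | succ n =>
    rw [Function.iterate_succ_apply']
    exact M.Bop_approx L _ (M.iter_sc L U hU n)

lemma R_approx (M : MRSetting X X₀) (L : X₀ →L[ℂ] X) (R : ℝ → (X₀ →L[ℂ] X₀))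
    (hRsc : ∀ x : X₀, ContinuousOn (fun t => R t x) (Ici 0))
    (hRfix : ∀ t ∈ Ici (0:ℝ), R t = M.T t + M.Bop L R t) : M.Approx R := by
  intro b
  obtain ⟨C, hC0, hC⟩ := M.Bop_approx L R hRsc b
  refine ⟨C, hC0, fun s h hs hh hb => ?_⟩
  have := hC s h hs hh hb
  rw [hRfix s hs, hRfix (s + h) (add_nonneg hs hh), ContinuousLinearMap.comp_add,
    ← M.T_add h s hh hs, add_comm h s, add_sub_add_left_eq_sub]
  exact this

end MRSetting

/-- compactness of `Sₙ` (resp. `Rₙ`) on `(t₁,∞)` implies norm continuity there. -/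
theorem compact_implies_norm_continuous (M : MRSetting X X₀) (L : X₀ →L[ℂ] X)
    (R : ℝ → (X₀ →L[ℂ] X₀))
    (hRsc : ∀ x : X₀, ContinuousOn (fun t => R t x) (Ici 0))
    (hRfix : ∀ t ∈ Ici (0:ℝ), R t = M.T t + M.Bop L R t)
    (n : ℕ) (t₁ : ℝ) (ht₁ : 0 ≤ t₁) :
    ((∀ t : ℝ, t₁ < t → IsCompactOperator ⇑((M.Bop L)^[n] M.T t)) →
      ContinuousOn ((M.Bop L)^[n] M.T) (Ioi t₁)) ∧
    ((∀ t : ℝ, t₁ < t → IsCompactOperator ⇑((M.Bop L)^[n] R t)) →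
      ContinuousOn ((M.Bop L)^[n] R) (Ioi t₁)) := by
  exact ⟨M.main _ (M.iter_approx L _ M.T_cont M.T_approx n) t₁ ht₁,
    M.main _ (M.iter_approx L _ hRsc (M.R_approx L R hRsc hRfix) n) t₁ ht₁⟩

end
end

section
/- Let F : (0,∞) → L(X, Y) be continuous in the operator norm and satisfy ‖F(t)‖ ≤ C₁ e^{ωt} for all t > 0. Then the following are equivalent: (i) F(t) is a compact operator for every t > 0; (ii) for every λ > ω and every μ ∈ ℝ, the Bochner integral ∫₀^∞ e^{−(λ+iμ)t} F(t) dt (which converges absolutely in L(X, Y)) is a compact operator; (iii) there exists λ > ω such that for every μ ∈ ℝ the integral ∫₀^∞ e^{−(λ+iμ)t} F(t) dt is a compact operator. -/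
open Set Filter MeasureTheory
open scoped Topology

noncomputable section

/-- Hahn-Banach: a closed subspace is the common kernel of the functionals vanishing on it. -/
theorem lc_mem_of_dual {E : Type*} [NormedAddCommGroup E] [NormedSpace ℂ E]
    (K : Submodule ℂ E) (hK : IsClosed (K : Set E)) (x : E)
    (h : ∀ φ : StrongDual ℂ E, (∀ y ∈ K, φ y = 0) → φ x = 0) : x ∈ K := by
  by_contra hx
  haveI := hK
  have hne : ‖(K.mkQL x)‖ ≠ 0 := by
    rw [norm_ne_zero_iff]
    intro h0
    exact hx ((Submodule.Quotient.mk_eq_zero K).1 h0)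
  obtain ⟨g, -, hg⟩ := exists_dual_vector ℂ (K.mkQL x) hne
  have h1 := h (g.comp K.mkQL) (by
    intro y hy
    have : K.mkQL y = 0 := (Submodule.Quotient.mk_eq_zero K).2 hy
    simp only [ContinuousLinearMap.comp_apply, this, map_zero])
  rw [ContinuousLinearMap.comp_apply, hg] at h1
  exact hne (RCLike.ofReal_eq_zero.1 h1)

theorem lc_integrable {E : Type*} [NormedAddCommGroup E] [NormedSpace ℂ E]
    (C₁ ω : ℝ) (F : ℝ → E) (hFc : ContinuousOn F (Ioi 0))
    (hFb : ∀ t : ℝ, 0 < t → ‖F t‖ ≤ C₁ * Real.exp (ω * t)) (l : ℝ) (hl : ω < l) (μ : ℝ) :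
    IntegrableOn
      (fun t : ℝ => Complex.exp (-((l : ℂ) + (μ : ℂ) * Complex.I) * (t : ℂ)) • F t) (Ioi 0) := by
  have hb : IntegrableOn (fun t : ℝ => C₁ * Real.exp ((ω - l) * t)) (Ioi 0) :=
    (integrableOn_exp_mul_Ioi (by linarith) 0).const_mul C₁
  refine Integrable.mono' hb ?_ ?_
  · refine ContinuousOn.aestronglyMeasurable ?_ measurableSet_Ioi
    exact ContinuousOn.smul (by fun_prop) hFc
  · refine (ae_restrict_iff' measurableSet_Ioi).2 (ae_of_all _ fun t ht => ?_)
    rw [norm_smul, Complex.norm_exp]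
    have h1 : (-((l : ℂ) + (μ : ℂ) * Complex.I) * (t : ℂ)).re = -l * t := by simp
    rw [h1]
    calc Real.exp (-l * t) * ‖F t‖ ≤ Real.exp (-l * t) * (C₁ * Real.exp (ω * t)) := by
          gcongr; exact hFb t ht
      _ = C₁ * Real.exp ((ω - l) * t) := by
          rw [show (ω - l) * t = -l * t + ω * t by ring, Real.exp_add]; ring

/-- Uniqueness for the Laplace transform along a vertical line. -/
theorem lc_unique (f : ℝ → ℂ) (hfc : ContinuousOn f (Ioi 0)) (l : ℝ)
    (hi : IntegrableOn (fun t : ℝ => Complex.exp (-(l : ℂ) * (t : ℂ)) * f t) (Ioi 0))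
    (h0 : ∀ μ : ℝ, ∫ t in Ioi (0:ℝ),
      Complex.exp (-((l : ℂ) + (μ : ℂ) * Complex.I) * (t : ℂ)) * f t = 0)
    (t : ℝ) (ht : 0 < t) : f t = 0 := by
  set g : ℝ → ℂ := (Ioi (0:ℝ)).indicator (fun t : ℝ => Complex.exp (-(l : ℂ) * (t : ℂ)) * f t)
    with hg
  have hgi : Integrable g := (integrable_indicator_iff measurableSet_Ioi).2 hi
  have hF : FourierTransform.fourier g = (0 : ℝ → ℂ) := by
    ext w
    rw [Real.fourier_real_eq_integral_exp_smul, Pi.zero_apply, ← h0 (2 * Real.pi * w),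
      ← integral_indicator measurableSet_Ioi]
    congr 1
    ext v
    by_cases hv : v ∈ Ioi (0:ℝ)
    · rw [hg, indicator_of_mem hv, indicator_of_mem hv, smul_eq_mul, ← mul_assoc,
        ← Complex.exp_add]
      congr 2
      push_cast
      ring
    · rw [hg, indicator_of_notMem hv, indicator_of_notMem hv, smul_zero]
  have hc : ContinuousAt g t := by
    have h1 : ContinuousAt (fun t : ℝ => Complex.exp (-(l : ℂ) * (t : ℂ)) * f t) t :=
      ContinuousAt.mul (by fun_prop) (hfc.continuousAt (Ioi_mem_nhds ht))
    refine h1.congr ?_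
    filter_upwards [Ioi_mem_nhds ht] with v hv
    rw [hg, indicator_of_mem hv]
  have h2 := hgi.fourierInv_fourier_eq (by rw [hF]; exact integrable_zero _ _ _) hc
  have h3 : g t = 0 := by
    rw [← h2, hF, Real.fourierInv_eq]
    simp
  rw [hg, indicator_of_mem (show t ∈ Ioi (0:ℝ) from ht)] at h3
  exact (mul_eq_zero.1 h3).resolve_left (Complex.exp_ne_zero _)

/-- a norm-continuous, exponentially bounded operator family is compact at every
`t > 0` iff its Laplace transform is compact along every vertical line `λ + iμ`,
for all / some `λ > ω`. -/
theorem laplace_compactness {X Y : Type*} [NormedAddCommGroup X] [NormedSpace ℂ X]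
    [NormedAddCommGroup Y] [NormedSpace ℂ Y] [CompleteSpace X] [CompleteSpace Y]
    (C₁ ω : ℝ) (hC₁ : 1 ≤ C₁)
    (F : ℝ → (X →L[ℂ] Y))
    (hFc : ContinuousOn F (Ioi 0))
    (hFb : ∀ t : ℝ, 0 < t → ‖F t‖ ≤ C₁ * Real.exp (ω * t)) :
    ((∀ t : ℝ, 0 < t → IsCompactOperator ⇑(F t)) ↔
      (∀ l : ℝ, ω < l → ∀ μ : ℝ,
        IntegrableOn
          (fun t : ℝ => Complex.exp (-((l : ℂ) + (μ : ℂ) * Complex.I) * (t : ℂ)) • F t)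
          (Ioi 0) ∧
        IsCompactOperator
          ⇑(∫ t in Ioi (0:ℝ),
              Complex.exp (-((l : ℂ) + (μ : ℂ) * Complex.I) * (t : ℂ)) • F t))) ∧
    ((∀ t : ℝ, 0 < t → IsCompactOperator ⇑(F t)) ↔
      (∃ l : ℝ, ω < l ∧ ∀ μ : ℝ,
        IsCompactOperator
          ⇑(∫ t in Ioi (0:ℝ),
              Complex.exp (-((l : ℂ) + (μ : ℂ) * Complex.I) * (t : ℂ)) • F t))) := by
  have hint := fun l hl μ => lc_integrable C₁ ω F hFc hFb l hl μ
  have hK : IsClosed (compactOperator (RingHom.id ℂ) X Y : Set (X →L[ℂ] Y)) :=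
    isClosed_setOfPred_isCompactOperator
  have h12 : (∀ t : ℝ, 0 < t → IsCompactOperator ⇑(F t)) → ∀ l : ℝ, ω < l → ∀ μ : ℝ,
      IsCompactOperator ⇑(∫ t in Ioi (0:ℝ),
        Complex.exp (-((l : ℂ) + (μ : ℂ) * Complex.I) * (t : ℂ)) • F t) := by
    intro h l hl μ
    refine lc_mem_of_dual (compactOperator (RingHom.id ℂ) X Y) hK _ fun φ hφ => ?_
    rw [← φ.integral_comp_comm (hint l hl μ)]
    refine setIntegral_eq_zero_of_forall_eq_zero fun t ht => ?_
    rw [map_smul, hφ (F t) (h t ht), smul_zero]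
  have h31 : (∃ l : ℝ, ω < l ∧ ∀ μ : ℝ,
        IsCompactOperator
          ⇑(∫ t in Ioi (0:ℝ),
              Complex.exp (-((l : ℂ) + (μ : ℂ) * Complex.I) * (t : ℂ)) • F t)) →
      ∀ t : ℝ, 0 < t → IsCompactOperator ⇑(F t) := by
    rintro ⟨l, hl, h⟩ t ht
    refine lc_mem_of_dual (compactOperator (RingHom.id ℂ) X Y) hK _ fun φ hφ => ?_
    refine lc_unique (fun t => φ (F t)) (φ.continuous.comp_continuousOn hFc) l ?_ ?_ t ht
    · have h1 := φ.integrable_comp (hint l hl 0)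
      simpa [IntegrableOn] using h1
    · intro μ
      have h1 := hφ _ (h μ)
      rw [← φ.integral_comp_comm (hint l hl μ)] at h1
      simpa only [map_smul, smul_eq_mul] using h1
  refine ⟨⟨fun h l hl μ => ⟨hint l hl μ, h12 h l hl μ⟩, fun h => h31 ⟨ω + 1, by linarith,
    fun μ => (h (ω + 1) (by linarith) μ).2⟩⟩, ⟨fun h => ⟨ω + 1, by linarith,
    fun μ => h12 h (ω + 1) (by linarith) μ⟩, h31⟩⟩

end
end
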